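/- For any three nonzero octonions x, y and z, with a = (z⁻¹(y⁻¹x⁻¹))(x(yz)) the multiplicative associator, one has (xy)z = (x(yz))·conj(a), where conj denotes octonion conjugation. -/

import Mathlib

/-!
Octonions `𝕆`, constructed from the quaternions `ℍ = Quaternion ℝ` by the
Cayley–Dickson doubling construction: an octonion is a pair `(a, b)` of
quaternions, with multiplication
  `(a, b) * (c, d) = (a*c - star d * b, d*a + b * star c)`,
conjugation `conj (a, b) = (star a, -b)`, norm `‖(a,b)‖ = √(‖a‖² + ‖b‖²)`,
and inverse `x⁻¹ = conj x / ‖x‖²` (with `0⁻¹ = 0`).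
-/

noncomputable section

/-- The octonions, as Cayley–Dickson pairs of real quaternions. -/
@[ext]
structure Octonion : Type where
  a : Quaternion ℝ
  b : Quaternion ℝ

namespace Octonion

instance : Zero Octonion := ⟨⟨0, 0⟩⟩
instance : One Octonion := ⟨⟨1, 0⟩⟩

/-- Cayley–Dickson multiplication of octonions. -/
instance : Mul Octonion :=
  ⟨fun x y => ⟨x.a * y.a - star y.b * x.b, y.b * x.a + x.b * star y.a⟩⟩

/-- Octonion conjugation. -/
def conj (x : Octonion) : Octonion := ⟨star x.a, -x.b⟩

/-- The (multiplicative) Euclidean norm of an octonion. -/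
instance : Norm Octonion := ⟨fun x => Real.sqrt (‖x.a‖ ^ 2 + ‖x.b‖ ^ 2)⟩

/-- The two-sided multiplicative inverse `x⁻¹ = conj x / ‖x‖²` (and `0⁻¹ = 0`). -/
instance : Inv Octonion :=
  ⟨fun x => ⟨(‖x‖ ^ 2)⁻¹ • (conj x).a, (‖x‖ ^ 2)⁻¹ • (conj x).b⟩⟩

end Octonion

namespace Octonion

def sm (r : ℝ) (x : Octonion) : Octonion := ⟨r • x.a, r • x.b⟩

def N (x : Octonion) : ℝ := Quaternion.normSq x.a + Quaternion.normSq x.b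

theorem mul_def' (x y : Octonion) :
    x * y = ⟨x.a * y.a - star y.b * x.b, y.b * x.a + x.b * star y.a⟩ := rfl

theorem inv_eq (x : Octonion) : x⁻¹ = sm (N x)⁻¹ (conj x) := by
  have h : ‖x‖ ^ 2 = N x := by
    change (Real.sqrt (‖x.a‖ ^ 2 + ‖x.b‖ ^ 2)) ^ 2 = _
    rw [Real.sq_sqrt (by positivity), N, Quaternion.normSq_eq_norm_mul_self,
      Quaternion.normSq_eq_norm_mul_self]
    ring
  change Octonion.mk ((‖x‖ ^ 2)⁻¹ • (conj x).a) ((‖x‖ ^ 2)⁻¹ • (conj x).b) = _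
  rw [h]; rfl

theorem N_ne {x : Octonion} (hx : x ≠ 0) : N x ≠ 0 := by
  intro h
  apply hx
  have h1 : 0 ≤ Quaternion.normSq x.a := Quaternion.normSq_nonneg
  have h2 : 0 ≤ Quaternion.normSq x.b := Quaternion.normSq_nonneg
  unfold N at h
  exact Octonion.ext (Quaternion.normSq_eq_zero.1 (by linarith))
    (Quaternion.normSq_eq_zero.1 (by linarith))

theorem conj_mul (x y : Octonion) : conj (x * y) = conj y * conj x := by
  ext1 <;> simp [mul_def', conj] <;> abel

theorem conj_conj (x : Octonion) : conj (conj x) = x := by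
  ext1 <;> simp [conj]

theorem conj_sm (r : ℝ) (x : Octonion) : conj (sm r x) = sm r (conj x) := by
  ext1 <;> simp [conj, sm]

theorem sm_mul (r : ℝ) (x y : Octonion) : sm r x * y = sm r (x * y) := by
  ext1 <;> simp [mul_def', sm, smul_sub]

theorem mul_sm (r : ℝ) (x y : Octonion) : x * sm r y = sm r (x * y) := by
  ext1 <;> simp [mul_def', sm, smul_sub]

theorem sm_sm (r s : ℝ) (x : Octonion) : sm r (sm s x) = sm (r * s) x := by
  ext1 <;> simp [sm, mul_smul]

theorem one_sm (x : Octonion) : sm 1 x = x := by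
  ext1 <;> simp [sm]

theorem N_mul (x y : Octonion) : N (x * y) = N x * N y := by
  simp only [N, mul_def', Quaternion.normSq_def']
  simp
  ring

theorem mul_conj_mul (x y : Octonion) : x * (conj x * y) = sm (N x) y := by
  ext <;> simp [N, mul_def', sm, conj, Quaternion.normSq_def'] <;> ring

end Octonion

/-- For any three nonzero octonions `x`, `y` and `z`, with
`a = (z⁻¹(y⁻¹x⁻¹))(x(yz))` the multiplicative associator, one has
`(xy)z = (x(yz)) · conj a`. -/
theorem octonion_associator_reverse (x y z : Octonion) (hx : x ≠ 0) (hy : y ≠ 0) (hz : z ≠ 0) :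
    (x * y) * z = (x * (y * z)) * Octonion.conj ((z⁻¹ * (y⁻¹ * x⁻¹)) * (x * (y * z))) := by
  have h1 := Octonion.N_ne hx
  have h2 := Octonion.N_ne hy
  have h3 := Octonion.N_ne hz
  simp only [Octonion.inv_eq, Octonion.sm_mul, Octonion.mul_sm, Octonion.sm_sm,
    ← Octonion.conj_mul, Octonion.conj_sm]
  rw [Octonion.conj_mul (Octonion.conj _), Octonion.conj_conj, Octonion.mul_conj_mul,
    Octonion.sm_sm, Octonion.N_mul, Octonion.N_mul]
  convert (Octonion.one_sm _).symm using 2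
  field_simp
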